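/- Let n ∈ ℕ, let μ > -1 and k > -1 be real numbers, and let α be a real number with n < α ≤ n+1. Then ∫_0^1 (1-τ)^μ τ^{k+α} P_{n+1}^{(μ,k)}(τ) dτ = Γ(α+1) B(α+1+k, n+μ+2) / ((n+1)! Γ(α-n)). -/

import Mathlib

open Real

/-- Generalized binomial coefficient `binom(a, i) = Γ(a+1)/(Γ(i+1) Γ(a-i+1))`. -/
noncomputable def gbinom (a : ℝ) (i : ℕ) : ℝ :=
  Real.Gamma (a + 1) / (Real.Gamma (i + 1) * Real.Gamma (a - i + 1))

/-- Shifted Jacobi polynomial on `[0,1]`. -/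
noncomputable def jacobiP (μ k : ℝ) (m : ℕ) (τ : ℝ) : ℝ :=
  ∑ j ∈ Finset.range (m + 1),
    gbinom (m + μ) j * gbinom (m + k) (m - j) * (τ - 1) ^ (m - j) * τ ^ j

/-- Beta function `B(p,q) = Γ(p)Γ(q)/Γ(p+q)`. -/
noncomputable def betaFn (p q : ℝ) : ℝ :=
  Real.Gamma p * Real.Gamma q / Real.Gamma (p + q)

open MeasureTheory Set

theorem ofReal_rpow_mul_one_sub_rpow (p q : ℝ) {x : ℝ} (hx : x ∈ Icc (0 : ℝ) 1) :
    (x : ℂ) ^ ((p : ℂ) - 1) * (1 - (x : ℂ)) ^ ((q : ℂ) - 1)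
      = ((x ^ (p - 1) * (1 - x) ^ (q - 1) : ℝ) : ℂ) := by
  rw [Complex.ofReal_mul, Complex.ofReal_cpow hx.1, Complex.ofReal_cpow (sub_nonneg.2 hx.2)]
  push_cast
  rfl

theorem intervalIntegrable_rpow_mul_one_sub_rpow {p q : ℝ} (hp : 0 < p) (hq : 0 < q) :
    IntervalIntegrable (fun x : ℝ => x ^ (p - 1) * (1 - x) ^ (q - 1)) volume 0 1 := by
  have h := Complex.betaIntegral_convergent (u := p) (v := q) (by simpa) (by simpa)
  rw [intervalIntegrable_iff_integrableOn_Ioc_of_le zero_le_one] at h ⊢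
  refine IntegrableOn.congr_fun h.re (fun x hx => ?_) measurableSet_Ioc
  rw [ofReal_rpow_mul_one_sub_rpow p q (Ioc_subset_Icc_self hx)]
  exact Complex.ofReal_re _

theorem integral_rpow_mul_one_sub_rpow {p q : ℝ} (hp : 0 < p) (hq : 0 < q) :
    ∫ x in (0 : ℝ)..1, x ^ (p - 1) * (1 - x) ^ (q - 1) = betaFn p q := by
  change _ = ProbabilityTheory.beta p q
  rw [ProbabilityTheory.beta_eq_betaIntegralReal p q hp hq, Complex.betaIntegral,
    intervalIntegral.integral_congr (g := fun x : ℝ =>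
      ((x ^ (p - 1) * (1 - x) ^ (q - 1) : ℝ) : ℂ)), intervalIntegral.integral_ofReal,
    Complex.ofReal_re]
  intro x hx
  rw [uIcc_of_le zero_le_one] at hx
  exact ofReal_rpow_mul_one_sub_rpow p q hx

/-- Iterated forward differences of a quotient of Gamma functions. -/
theorem fwdDiff_iter_Gamma_div_Gamma {a b : ℝ} (ha : 0 < a) (hb : 0 < b) (m : ℕ)
    (hm : (m : ℝ) < b - a + 1) (x : ℕ) :
    (fwdDiff 1)^[m] (fun i : ℕ => Gamma (b + i) / Gamma (a + i)) x
      = Gamma (b - a + 1) / Gamma (b - a - m + 1) * (Gamma (b + x) / Gamma (a + x + m)) := by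
  induction m generalizing x with
  | zero =>
    have : Gamma (b - a + 1) ≠ 0 := (Gamma_pos_of_pos (by simpa using hm)).ne'
    simp [this]
  | succ m ih =>
    push_cast at hm ⊢
    rw [Function.iterate_succ_apply', fwdDiff, ih (by linarith), ih (by linarith)]
    have hax : 0 < a + x + m := by positivity
    have hbx : 0 < b + x := by positivity
    have hd : 0 < b - a - m := by linarith
    have e1 : a + ((x + 1 : ℕ) : ℝ) + m = (a + x + m) + 1 := by push_cast; ring
    have e2 : b + ((x + 1 : ℕ) : ℝ) = (b + x) + 1 := by push_cast; ring
    have e3 : a + x + (m + 1 : ℝ) = (a + x + m) + 1 := by ring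
    have e4 : b - a - (m + 1 : ℝ) + 1 = b - a - m := by ring
    rw [e1, e2, e3, e4, Gamma_add_one hax.ne', Gamma_add_one hbx.ne', Gamma_add_one hd.ne']
    have h1 := (Gamma_pos_of_pos hax).ne'
    have h2 := (Gamma_pos_of_pos hd).ne'
    field_simp
    ring

theorem sum_neg_one_pow_choose_Gamma_div_Gamma {a b : ℝ} (ha : 0 < a) (hb : 0 < b) (m : ℕ)
    (hm : (m : ℝ) < b - a + 1) :
    ∑ j ∈ Finset.range (m + 1),
        (-1 : ℝ) ^ (m - j) * (m.choose j : ℝ) * (Gamma (b + j) / Gamma (a + j))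
      = Gamma (b - a + 1) / Gamma (b - a - m + 1) * (Gamma b / Gamma (a + m)) := by
  have h := fwdDiff_iter_Gamma_div_Gamma ha hb m hm 0
  rw [fwdDiff_iter_eq_sum_shift] at h
  simpa using h

theorem weight_mul_jacobiP_eq_sum (μ k α : ℝ) (m : ℕ) {τ : ℝ} (hτ : τ ∈ Ioo (0 : ℝ) 1) :
    (1 - τ) ^ μ * τ ^ (k + α) * jacobiP μ k m τ
      = ∑ j ∈ Finset.range (m + 1),
        (gbinom (m + μ) j * gbinom (m + k) (m - j) * (-1) ^ (m - j)) *
          (τ ^ ((k + α + 1 + j) - 1) * (1 - τ) ^ ((μ + 1 + (m - j : ℕ)) - 1)) := by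
  rw [jacobiP, Finset.mul_sum]
  refine Finset.sum_congr rfl fun j _ => ?_
  have e1 : k + α + 1 + j - 1 = k + α + j := by ring
  have e2 : μ + 1 + ((m - j : ℕ) : ℝ) - 1 = μ + (m - j : ℕ) := by ring
  rw [e1, e2, rpow_add_natCast hτ.1.ne', rpow_add_natCast (sub_pos.2 hτ.2).ne',
    ← neg_sub 1 τ, neg_pow]
  ring

theorem gbinom_mul_gbinom_mul_betaFn {μ : ℝ} (k α : ℝ) (hμ : -1 < μ)
    {m j : ℕ} (hj : j ≤ m) :
    (gbinom (m + μ) j * gbinom (m + k) (m - j) * (-1) ^ (m - j)) *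
        betaFn (k + α + 1 + j) (μ + 1 + (m - j : ℕ))
      = Gamma (m + μ + 1) * Gamma (k + 1 + m) / (m.factorial * Gamma (k + α + m + μ + 2)) *
        ((-1) ^ (m - j) * (m.choose j : ℝ) *
          (Gamma (k + α + 1 + j) / Gamma (k + 1 + j))) := by
  have e1 : (m : ℝ) + μ - j + 1 = μ + 1 + (m - j : ℕ) := by
    rw [Nat.cast_sub hj]; ring
  have e2 : (m : ℝ) + k - (m - j : ℕ) + 1 = k + 1 + j := by
    rw [Nat.cast_sub hj]; ring
  have e3 : k + α + 1 + j + (μ + 1 + (m - j : ℕ)) = k + α + m + μ + 2 := by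
    rw [Nat.cast_sub hj]; ring
  have e4 : (m : ℝ) + k + 1 = k + 1 + m := by ring
  have h1 : Gamma (μ + 1 + (m - j : ℕ)) ≠ 0 :=
    (Gamma_pos_of_pos (by have := (m - j).cast_nonneg (α := ℝ); linarith)).ne'
  have hc : (m.choose j : ℝ) = m.factorial / (j.factorial * (m - j).factorial) :=
    Nat.cast_choose ℝ hj
  have hf (i : ℕ) : (i.factorial : ℝ) ≠ 0 := by positivity
  have hm := hf m
  have hj' := hf j
  have hmj := hf (m - j)
  rw [gbinom, gbinom, betaFn, e1, e2, e3, e4, hc, Gamma_nat_eq_factorial,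
    Gamma_nat_eq_factorial]
  field_simp

/-- The integral of the degree-`(n+1)` shifted Jacobi polynomial against the
weight `(1-τ)^μ τ^{k+α}`. -/
theorem jacobi_integral_against_fractional_monomial
    (n : ℕ) (μ k : ℝ) (hμ : -1 < μ) (hk : -1 < k)
    (α : ℝ) (hα1 : (n : ℝ) < α) (hα2 : α ≤ n + 1) :
    ∫ τ in (0 : ℝ)..1, (1 - τ) ^ μ * τ ^ (k + α) * jacobiP μ k (n + 1) τ
      = Real.Gamma (α + 1) * betaFn (α + 1 + k) (n + μ + 2)
          / ((Nat.factorial (n + 1) : ℝ) * Real.Gamma (α - n)) := by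
  have hα : 0 < α := n.cast_nonneg.trans_lt hα1
  have hp (j : ℕ) : 0 < k + α + 1 + j := by
    have := j.cast_nonneg (α := ℝ); linarith
  have hq (j : ℕ) : 0 < μ + 1 + j := by
    have := j.cast_nonneg (α := ℝ); linarith
  rw [intervalIntegral.integral_congr_Ioo_of_le zero_le_one fun τ hτ =>
      weight_mul_jacobiP_eq_sum μ k α (n + 1) hτ,
    intervalIntegral.integral_finsetSum fun j _ =>
      (intervalIntegrable_rpow_mul_one_sub_rpow (hp j) (hq _)).const_mul _]
  simp_rw [intervalIntegral.integral_const_mul, integral_rpow_mul_one_sub_rpow (hp _) (hq _)]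
  rw [Finset.sum_congr rfl fun j hj => gbinom_mul_gbinom_mul_betaFn k α hμ
      (Nat.lt_succ_iff.1 (Finset.mem_range.1 hj)), ← Finset.mul_sum,
    sum_neg_one_pow_choose_Gamma_div_Gamma (by linarith) (by linarith) (n + 1)
      (by push_cast; linarith)]
  have hk' : Gamma (k + 1 + (n + 1 : ℕ)) ≠ 0 :=
    (Gamma_pos_of_pos (by push_cast; linarith [n.cast_nonneg (α := ℝ)])).ne'
  rw [betaFn]
  push_cast at hk' ⊢
  rw [show k + α + 1 - (k + 1) + 1 = α + 1 by ring,
    show k + α + 1 - (k + 1) - ((n : ℝ) + 1) + 1 = α - n by ring,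
    show (n : ℝ) + 1 + μ + 1 = n + μ + 2 by ring,
    show k + α + 1 = α + 1 + k by ring,
    show k + α + ((n : ℝ) + 1) + μ + 2 = α + 1 + k + (n + μ + 2) by ring]
  field_simp
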